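/- If there exists a continuum which has semispan zero and is not chainable, then there exists a metrizable continuum which has semispan zero and is not chainable. -/

import Mathlib

/-- A continuum `X` is chainable if every finite open cover has a finite open
refinement that can be enumerated as `V_0, …, V_{n-1}` with
`V_i ∩ V_j ≠ ∅` iff `|i - j| ≤ 1`. -/
def Chainable (X : Type*) [TopologicalSpace X] : Prop :=
  ∀ U : Finset (Set X), (∀ u ∈ U, IsOpen u) → ⋃₀ (U : Set (Set X)) = Set.univ →
    ∃ (n : ℕ) (V : Fin n → Set X),
      (∀ i, IsOpen (V i)) ∧ (⋃ i, V i) = Set.univ ∧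
      (∀ i, ∃ u ∈ U, V i ⊆ u) ∧
      ∀ i j : Fin n, (V i ∩ V j).Nonempty ↔ |((i : ℕ) : ℤ) - ((j : ℕ) : ℤ)| ≤ 1

/-- A continuum has semispan zero if every subcontinuum `Z` of `X × X` with
`π₁[Z] ⊆ π₂[Z]` meets the diagonal. -/
def SemispanZero (X : Type*) [TopologicalSpace X] : Prop :=
  ∀ Z : Set (X × X), IsClosed Z → IsConnected Z →
    Prod.fst '' Z ⊆ Prod.snd '' Z → ∃ x : X, (x, x) ∈ Z

open Set Filter Topology Uniformity

/-- `F` is a nonempty set that looks, at scale `D`, like a connected set with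
`π₁[F] ⊆ π₂[F]`. -/
def BadAt {X : Type*} (D F : Set (X × X)) : Prop :=
  F.Nonempty ∧ (∀ p ∈ F, ∃ q ∈ F, (p.1, q.2) ∈ D) ∧
    ∀ A, A ⊆ F → A.Nonempty →
      (∀ p ∈ A, ∀ q ∈ F, (p.1, q.1) ∈ D → (p.2, q.2) ∈ D → q ∈ A) → F ⊆ A

theorem BadAt.mono {X : Type*} {D D' F : Set (X × X)} (h : D ⊆ D') (hF : BadAt D F) :
    BadAt D' F :=
  ⟨hF.1, fun p hp => (hF.2.1 p hp).imp fun _ hq => ⟨hq.1, h hq.2⟩,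
    fun A hA hn hc => hF.2.2 A hA hn fun p hp q hq h1 h2 => hc p hp q hq (h h1) (h h2)⟩

/-- Uniform version of semispan zero. -/
def UnifSemispan (X : Type*) [UniformSpace X] : Prop :=
  ∀ E ∈ 𝓤 X, ∃ D ∈ 𝓤 X, ∀ F, BadAt D F → (F ∩ E).Nonempty

theorem unifSemispan_of {X : Type*} [UniformSpace X] [CompactSpace X] [T2Space X]
    (h : SemispanZero X) : UnifSemispan X := by
  intro E hE
  by_contra! hcon
  choose! F hF hFE using hcon
  have hne : NeBot ((𝓤 X).smallSets ⊓ 𝓟 {D | D ∈ 𝓤 X}) :=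
    frequently_mem_iff_neBot.1 (frequently_smallSets_mem (𝓤 X))
  let l : Ultrafilter (Set (X × X)) := Ultrafilter.of ((𝓤 X).smallSets ⊓ 𝓟 {D | D ∈ 𝓤 X})
  have hl : (l : Filter (Set (X × X))) ≤ (𝓤 X).smallSets ⊓ 𝓟 {D | D ∈ 𝓤 X} :=
    Ultrafilter.of_le _
  have hsub : ∀ D ∈ 𝓤 X, ∀ᶠ D' in (l : Filter (Set (X × X))), D' ⊆ D := fun D hD =>
    (hl.trans inf_le_left) (eventually_smallSets_subset.2 hD)
  have hmem : ∀ᶠ D' in (l : Filter (Set (X × X))), D' ∈ 𝓤 X :=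
    (hl.trans inf_le_right) (mem_principal_self _)
  let Z : Set (X × X) :=
    {p | ∀ N ∈ 𝓝 p, ∀ᶠ D in (l : Filter (Set (X × X))), (F D ∩ N).Nonempty}
  have hZc : IsClosed Z := by
    rw [← isOpen_compl_iff, isOpen_iff_mem_nhds]
    intro p hp
    have hp' : ¬ ∀ N ∈ 𝓝 p, ∀ᶠ D in (l : Filter (Set (X × X))), (F D ∩ N).Nonempty := hp
    push Not at hp'
    obtain ⟨N, hN, hNl⟩ := hp'
    filter_upwards [eventually_mem_nhds_iff.2 hN] with r hr hrZ
    obtain ⟨D, hD1, hD2⟩ := (hNl.and (hrZ N hr)).exists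
    rw [hD1] at hD2
    exact Set.not_nonempty_empty hD2
  have hlim : ∀ K : Set (X × X), IsClosed K →
      (∀ᶠ D in (l : Filter (Set (X × X))), (F D ∩ K).Nonempty) → (Z ∩ K).Nonempty := by
    intro K hK hev
    have hch : ∀ D, ∃ z, (F D ∩ K).Nonempty → z ∈ F D ∩ K := by
      intro D
      by_cases hD : (F D ∩ K).Nonempty
      · exact hD.imp fun z hz _ => hz
      · obtain ⟨D', z, hz⟩ := hev.exists
        exact ⟨z, fun h => (hD h).elim⟩
    choose z hz using hch
    have hzK : K ∈ l.map z := by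
      change ∀ᶠ D in (l : Filter (Set (X × X))), z D ∈ K
      filter_upwards [hev] with D hD using (hz D hD).2
    obtain ⟨p, hpK, hp⟩ := hK.isCompact.ultrafilter_le_nhds' (l.map z) hzK
    refine ⟨p, fun N hN => ?_, hpK⟩
    have hzN : ∀ᶠ D in (l : Filter (Set (X × X))), z D ∈ N := hp hN
    filter_upwards [hev, hzN] with D hD hDN using ⟨z D, (hz D hD).1, hDN⟩
  have hZne : Z.Nonempty := by
    refine (hlim univ isClosed_univ ?_).mono inter_subset_left
    filter_upwards [hmem] with D hD
    simpa using (hF D hD).1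
  have hZpre : IsPreconnected Z := by
    rw [isPreconnected_iff_subset_of_fully_disjoint_closed hZc]
    intro u v hu hv huv hd
    by_contra! hcon
    obtain ⟨⟨p, hpZ, hpu⟩, ⟨r, hrZ, hrv⟩⟩ := And.intro (not_subset.1 hcon.1) (not_subset.1 hcon.2)
    have hpv : p ∈ v := (huv hpZ).resolve_left hpu
    have hru : r ∈ u := (huv hrZ).resolve_right hrv
    obtain ⟨f, hf0, hf1, -⟩ := exists_continuous_zero_one_of_isClosed hu hv hd
    have hfu : UniformContinuous f := CompactSpace.uniformContinuous_of_continuous f.continuous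
    have hW : {x : (X × X) × (X × X) | dist (f x.1) (f x.2) < 1 / 3} ∈ 𝓤 (X × X) :=
      hfu (Metric.dist_mem_uniformity (by norm_num))
    obtain ⟨D1, hD1, hD1W⟩ : ∃ D1 ∈ 𝓤 X, ∀ a b : X × X, (a.1, b.1) ∈ D1 → (a.2, b.2) ∈ D1 →
        dist (f a) (f b) < 1 / 3 := by
      rw [uniformity_prod_eq_prod, mem_map, mem_prod_same_iff] at hW
      obtain ⟨t, ht, htW⟩ := hW
      exact ⟨t, ht, fun a b h1 h2 => htW (mk_mem_prod h1 h2)⟩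
    have e1 : ∀ᶠ D in (l : Filter (Set (X × X))), (F D ∩ {x | f x < 1 / 3}).Nonempty := by
      refine hrZ _ ((isOpen_lt f.continuous continuous_const).mem_nhds ?_)
      have := hf0 hru
      simp only [mem_ofPred_eq]
      rw [this]; norm_num
    have e2 : ∀ᶠ D in (l : Filter (Set (X × X))), (F D ∩ {x | 2 / 3 < f x}).Nonempty := by
      refine hpZ _ ((isOpen_lt continuous_const f.continuous).mem_nhds ?_)
      have := hf1 hpv
      simp only [mem_ofPred_eq]
      rw [this]; norm_num
    have e3 : ∀ᶠ D in (l : Filter (Set (X × X))),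
        ¬ (F D ∩ {x | 1 / 3 ≤ f x ∧ f x ≤ 2 / 3}).Nonempty := by
      rw [← Ultrafilter.frequently_iff_eventually]
      refine fun hcon => ?_
      have hcon' : ∀ᶠ D in (l : Filter (Set (X × X))),
        (F D ∩ {x | 1 / 3 ≤ f x ∧ f x ≤ 2 / 3}).Nonempty := by simpa using hcon
      obtain ⟨w, hwZ, hw1, hw2⟩ := hlim _ ((isClosed_le continuous_const f.continuous).inter
        (isClosed_le f.continuous continuous_const)) hcon'
      rcases huv hwZ with hw | hw
      · have := hf0 hw
        simp only [Pi.zero_apply, mem_ofPred_eq] at this hw1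
        linarith
      · have := hf1 hw
        simp only [Pi.one_apply, mem_ofPred_eq] at this hw2
        linarith
    obtain ⟨D, hDm, hDs, ⟨a, ha, hfa⟩, ⟨b, hb, hfb⟩, h3⟩ :=
      (hmem.and ((hsub D1 hD1).and (e1.and (e2.and e3)))).exists
    have := (hF D hDm).2.2 (F D ∩ {x | f x < 1 / 3}) inter_subset_left ⟨a, ha, hfa⟩ (by
      rintro c ⟨hc, hfc⟩ d hd h1 h2
      refine ⟨hd, ?_⟩
      have hdist := hD1W c d (hDs h1) (hDs h2)
      rw [Real.dist_eq, abs_lt] at hdist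
      simp only [mem_ofPred_eq] at hfc ⊢
      by_contra! hge
      exact h3 ⟨d, hd, hge, by linarith⟩) hb
    have h5 : f b < 1 / 3 := this.2
    have h6 : 2 / 3 < f b := hfb
    linarith
  have hZproj : Prod.fst '' Z ⊆ Prod.snd '' Z := by
    rintro _ ⟨p, hp, rfl⟩
    by_contra hx
    have hcl : IsClosed (Prod.snd '' Z) := (hZc.isCompact.image continuous_snd).isClosed
    have hnb : (Prod.snd '' Z)ᶜ ∈ 𝓝 p.1 := hcl.isOpen_compl.mem_nhds hx
    obtain ⟨V, hV, hVc, hVs⟩ := exists_mem_nhds_isClosed_subset hnb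
    obtain ⟨D1, hD1, hD1V⟩ := UniformSpace.mem_nhds_iff.1 hV
    obtain ⟨D2, hD2, hD2c⟩ := comp_mem_uniformity_sets hD1
    have e1 := hp (Prod.fst ⁻¹' UniformSpace.ball p.1 D2)
      (continuous_fst.continuousAt.preimage_mem_nhds (UniformSpace.ball_mem_nhds _ hD2))
    obtain ⟨w, hwZ, hwV⟩ := hlim (Prod.snd ⁻¹' V) (hVc.preimage continuous_snd) (by
      filter_upwards [e1, hmem, hsub D2 hD2] with D ⟨a, ha, hab⟩ hDm hDs
      obtain ⟨b, hb, hab'⟩ := (hF D hDm).2.1 a ha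
      exact ⟨b, hb, hD1V (hD2c ⟨a.1, hab, hDs hab'⟩)⟩)
    exact hVs hwV ⟨w, hwZ, rfl⟩
  obtain ⟨x, hx⟩ := h Z hZc ⟨hZne, hZpre⟩ hZproj
  have hEn : E ∈ 𝓝 (x, x) := nhds_le_uniformity x hE
  obtain ⟨D, hD, hDm⟩ := ((hx E hEn).and hmem).exists
  rw [hFE D hDm] at hD
  exact Set.not_nonempty_empty hD

theorem stage_two {X : Type*} [UniformSpace X] [CompactSpace X] [ConnectedSpace X]
    [IsCountablyGenerated (𝓤 X)] (hs : UnifSemispan X) (hc : ¬ Chainable X) :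
    ∃ (Y : Type) (_ : TopologicalSpace Y),
      TopologicalSpace.MetrizableSpace Y ∧
      CompactSpace Y ∧ T2Space Y ∧ ConnectedSpace Y ∧ SemispanZero Y ∧ ¬ Chainable Y := by
  have : TopologicalSpace.PseudoMetrizableSpace X := inferInstance
  obtain ⟨f, hf⟩ := TopologicalSpace.exists_isInducing_l_infty X
  let q : X → range f := rangeFactorization f
  have hq : IsInducing q := by
    exact IsInducing.of_comp (hf.continuous.subtype_mk _) continuous_subtype_val hf
  have hqs : Function.Surjective q := rangeFactorization_surjective
  refine ⟨range f, inferInstance, inferInstance, isCompact_iff_compactSpace.1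
    (isCompact_range hf.continuous), inferInstance,
    Subtype.connectedSpace (isConnected_range hf.continuous), ?_, ?_⟩
  · intro Z hZc hZ hsub
    by_contra! hdiag
    have hqq : IsInducing (Prod.map q q) := hq.prodMap hq
    set Z' := Prod.map q q ⁻¹' Z with hZ'
    have him : Prod.map q q '' Z' = Z := image_preimage_eq _ (hqs.prodMap hqs)
    have hZ'conn : IsPreconnected Z' := by
      rw [← hqq.isPreconnected_image, him]; exact hZ.isPreconnected
    have hE : Z'ᶜ ∈ 𝓤 X := by
      rw [← nhdsSet_diagonal_eq_uniformity]
      refine (hZc.preimage hqq.continuous).isOpen_compl.mem_nhdsSet.2 ?_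
      rintro ⟨x, y⟩ (rfl : x = y)
      exact hdiag (q x)
    obtain ⟨D, hD, hbad⟩ := hs _ hE
    suffices hB : BadAt D Z' by
      obtain ⟨z, hz, hz'⟩ := hbad Z' hB
      exact hz' hz
    refine ⟨?_, ?_, ?_⟩
    · obtain ⟨z, hz⟩ := hZ.nonempty
      rw [← him] at hz
      exact hz.imp fun _ h => h.1
    · intro p hp
      obtain ⟨w, hw, hwp⟩ := hsub ⟨_, hp, rfl⟩
      rw [← him] at hw
      obtain ⟨r, hr, rfl⟩ := hw
      refine ⟨r, hr, ?_⟩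
      have hins : Inseparable p.1 r.2 := by
        rw [← hq.inseparable_iff]
        exact Inseparable.of_eq hwp.symm
      have := hins.nhds_le_uniformity hD
      exact mem_of_mem_nhds this
    · rintro A hA ⟨a, ha⟩ hcl b hb
      have key := hZ'conn.induction₂' (fun x y => x ∈ A ↔ y ∈ A) ?_ ?_ (hA ha) hb
      · exact key.1 ha
      · intro x hx
        have e : ∀ a : X, ∀ᶠ b in 𝓝 a, (a, b) ∈ D ∧ (b, a) ∈ D := fun a =>
          inter_mem (mem_nhds_left a hD) (mem_nhds_right a hD)
        have e1 := (continuous_fst.tendsto x).eventually (e x.1)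
        have e2 := (continuous_snd.tendsto x).eventually (e x.2)
        filter_upwards [mem_nhdsWithin_of_mem_nhds (e1.and e2), self_mem_nhdsWithin]
          with y hy hyZ
        have : x ∈ A ↔ y ∈ A :=
          ⟨fun h => hcl x h y hyZ hy.1.1 hy.2.1, fun h => hcl y h x hx hy.1.2 hy.2.2⟩
        exact ⟨this, this.symm⟩
      · intro x y z _ _ _ h1 h2; exact h1.trans h2
  · intro hch
    apply hc
    intro U hU hcov
    have : ∀ u ∈ U, ∃ w, IsOpen w ∧ q ⁻¹' w = u := fun u hu => hq.isOpen_iff.1 (hU u hu)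
    choose! w hwo hwu using this
    classical
    obtain ⟨n, V, hVo, hVc, hVr, hVi⟩ := hch (U.image w) (by simpa using hwo) (by
      rw [eq_univ_iff_forall]
      intro y
      obtain ⟨x, rfl⟩ := hqs y
      obtain ⟨u, hu, hx⟩ := hcov.symm ▸ mem_univ x
      refine ⟨w u, by simpa using ⟨u, hu, rfl⟩, ?_⟩
      rw [← hwu u hu] at hx; exact hx)
    refine ⟨n, fun i => q ⁻¹' V i, fun i => (hVo i).preimage hq.continuous, ?_, ?_, ?_⟩
    · rw [← preimage_iUnion, hVc, preimage_univ]
    · intro i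
      obtain ⟨u', hu', hi⟩ := hVr i
      obtain ⟨u, hu, rfl⟩ := Finset.mem_image.1 hu'
      exact ⟨u, hu, by rw [← hwu u hu]; exact preimage_mono hi⟩
    · intro i j
      rw [← hVi, ← preimage_inter]
      exact ⟨fun ⟨x, hx⟩ => ⟨_, hx⟩, fun h => h.preimage hqs⟩

theorem stage_one {X : Type*} [UX : UniformSpace X] [CompactSpace X] 
    (hs : UnifSemispan X) (hc : ¬ Chainable X) :
    ∃ U' : UniformSpace X, UX ≤ U' ∧ IsCountablyGenerated 𝓤[U'] ∧ @UnifSemispan X U' ∧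
      ¬ @Chainable X U'.toTopologicalSpace := by
  unfold Chainable at hc
  push Not at hc
  obtain ⟨U, hUo, hUc, hUn⟩ := hc
  obtain ⟨D0, hD0, hleb⟩ := lebesgue_number_lemma_sUnion (K := (univ : Set X)) isCompact_univ
    (S := (U : Set (Set X))) hUo hUc.ge
  have step : ∀ E : Set (X × X), ∃ D : Set (X × X), E ∈ 𝓤 X → D ∈ 𝓤 X ∧ SetRel.IsSymm D ∧
      SetRel.comp D D ⊆ E ∧ ∀ F, BadAt D F → (F ∩ E).Nonempty := by
    intro E
    by_cases hE : E ∈ 𝓤 X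
    · obtain ⟨D1, hD1, hb⟩ := hs E hE
      obtain ⟨D2, hD2, hsy, hco⟩ := comp_symm_mem_uniformity_sets (inter_mem hE hD1)
      refine ⟨D2, fun _ => ⟨hD2, hsy, hco.trans inter_subset_left, fun F hF => hb F (hF.mono ?_)⟩⟩
      refine Subset.trans ?_ (hco.trans inter_subset_right)
      rintro ⟨x, y⟩ hxy
      exact ⟨y, hxy, refl_mem_uniformity hD2⟩
    · exact ⟨∅, fun h => (hE h).elim⟩
  choose g hg using step
  let D : ℕ → Set (X × X) := fun n => g^[n] D0
  have hDs : ∀ n, D (n + 1) = g (D n) := fun n => Function.iterate_succ_apply' _ _ _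
  have hDu : ∀ n, D n ∈ 𝓤 X := by
    intro n
    induction n with
    | zero => exact hD0
    | succ n ih => rw [hDs]; exact (hg _ ih).1
  have hDle : ∀ n, D (n + 1) ⊆ D n := by
    intro n
    refine Subset.trans ?_ (hg _ (hDu n)).2.2.1
    rw [← hDs]
    rintro ⟨x, y⟩ hxy
    exact ⟨y, hxy, refl_mem_uniformity (hDu _)⟩
  have hanti : Antitone D := antitone_nat_of_succ_le hDle
  have hbasis : (⨅ n, 𝓟 (D n)).HasAntitoneBasis D := .iInf_principal hanti
  let C : UniformSpace.Core X := UniformSpace.Core.mk' (⨅ n, 𝓟 (D n))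
    (by
      intro r hr x
      obtain ⟨n, hn⟩ := hbasis.mem_iff.1 hr
      exact hn (refl_mem_uniformity (hDu n)))
    (by
      intro r hr
      obtain ⟨n, hn⟩ := hbasis.mem_iff.1 hr
      refine hbasis.mem_iff.2 ⟨n + 1, ?_⟩
      rintro ⟨x, y⟩ hxy
      have := (hg _ (hDu n)).2.1
      rw [← hDs] at this
      exact hn (hDle n (this.symm _ _ hxy)))
    (by
      intro r hr
      obtain ⟨n, hn⟩ := hbasis.mem_iff.1 hr
      refine ⟨D (n + 1), hbasis.mem _, Subset.trans ?_ hn⟩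
      rw [hDs]
      exact (hg _ (hDu n)).2.2.1)
  let U' := UniformSpace.ofCore C
  have hU'b : 𝓤[U'].HasAntitoneBasis D := hbasis
  have hle : UX ≤ U' := by
    intro r hr
    obtain ⟨n, hn⟩ := hU'b.mem_iff.1 hr
    exact mem_of_superset (hDu n) hn
  refine ⟨U', hle, hU'b.isCountablyGenerated, ?_, ?_⟩
  · intro E hE
    obtain ⟨n, hn⟩ := hU'b.mem_iff.1 hE
    refine ⟨D (n + 1), hU'b.mem _, fun F hF => ?_⟩
    rw [hDs] at hF
    exact ((hg _ (hDu n)).2.2.2 F hF).mono (inter_subset_inter_right _ hn)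
  · intro hch
    classical
    obtain ⟨n, V, hVo, hVc, hVr, hVi⟩ := hch (U.image (@interior X U'.toTopologicalSpace))
      (by
        simp only [Finset.mem_image, forall_exists_index, and_imp, forall_apply_eq_imp_iff₂]
        intro u _
        exact @isOpen_interior X U'.toTopologicalSpace u)
      (by
        rw [eq_univ_iff_forall]
        intro x
        obtain ⟨u, hu, hx⟩ := hleb x (mem_univ x)
        refine ⟨_, Finset.mem_coe.2 (Finset.mem_image_of_mem _ hu), ?_⟩
        rw [@mem_interior_iff_mem_nhds X U'.toTopologicalSpace]
        exact mem_of_superset (@UniformSpace.ball_mem_nhds X U' x _ (hU'b.mem 0)) hx)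
    have hcl := hUn n V (fun i => UniformSpace.toTopologicalSpace_mono hle _ (hVo i)) hVc
      (by
        intro i
        obtain ⟨u', hu', hi⟩ := hVr i
        obtain ⟨u, hu, rfl⟩ := Finset.mem_image.1 hu'
        exact ⟨u, hu, hi.trans (@interior_subset X U'.toTopologicalSpace _)⟩)
    obtain ⟨i, j, hij⟩ := hcl
    have := hVi i j
    rw [← Set.not_nonempty_iff_eq_empty, ← not_le] at hij
    tauto

theorem nonmetric_to_metric_counterexample_9 :
    (∃ (X : Type u) (_ : TopologicalSpace X),
      CompactSpace X ∧ T2Space X ∧ ConnectedSpace X ∧ SemispanZero X ∧ ¬ Chainable X) →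
    ∃ (Y : Type) (_ : TopologicalSpace Y),
      TopologicalSpace.MetrizableSpace Y ∧
      CompactSpace Y ∧ T2Space Y ∧ ConnectedSpace Y ∧ SemispanZero Y ∧ ¬ Chainable Y := by
  rintro ⟨X, tX, h1, h2, h3, h4, h5⟩
  let UX : UniformSpace X := uniformSpaceOfCompactR1
  obtain ⟨U', hle, hcg, hs, hc⟩ := stage_one (unifSemispan_of h4) h5
  have hle' : tX ≤ U'.toTopologicalSpace := UniformSpace.toTopologicalSpace_mono hle
  have hcont : @Continuous X X tX U'.toTopologicalSpace id := continuous_id_iff_le.2 hle'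
  have hcomp : @CompactSpace X U'.toTopologicalSpace :=
    @Function.Surjective.compactSpace X X tX U'.toTopologicalSpace id hcont _ Function.surjective_id
  have hconn : @ConnectedSpace X U'.toTopologicalSpace :=
    @Function.Surjective.connectedSpace X X tX _ U'.toTopologicalSpace id
      Function.surjective_id hcont
  exact @stage_two X U' hcomp hconn hcg hs hc
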